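/- (Multi-constraint power digital option, Lemma 3.) Let ψ be an admissible characteristic exponent of order ν ∈ (0,2] and type [λ₋, λ₊], let τ > 0, x ∈ ℝ, r ∈ ℝ, and let Y be a real random variable with characteristic exponent ψ over time τ; set X = x + Y. Let γ ∈ ℝ, and for n = 1, …, N let a_n ≠ 0, K_n ∈ ℝ, w_n ∈ {−1, 1} and ω_n > 0 be such that Σ_{n=1}^N w_n ω_n a_n + γ ∈ (−λ₊, −λ₋). Then e^{−rτ} E[e^{γX} ∏_{n=1}^N 1(w_n a_n X ≥ w_n K_n)] = (e^{−rτ} e^{γx} ∏_{n=1}^N w_n / (2πi)^N) ∫_{Im ξ_N = −w_N ω_N} ⋯ ∫_{Im ξ_1 = −w_1 ω_1} exp(i Σ_{n=1}^N ξ_n (a_n x − K_n) − τ ψ(Σ_{n=1}^N a_n ξ_n − iγ)) / (ξ_1 ⋯ ξ_N) dξ_1 ⋯ dξ_N, where the N-fold contour integral is understood as an iterated improper integral computed in the order dξ_1, then dξ_2, …, then dξ_N, each of these iterated integrals being assumed to exist. -/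

import Mathlib

open MeasureTheory Real Complex ProbabilityTheory

/-- `ψ` is an admissible characteristic exponent of order `ν ∈ (0,2]` and type `[lm, lp]`
(`lm < 0 < lp`): continuous on the closed strip `lm ≤ Im ζ ≤ lp`, holomorphic in its
interior, vanishing at `0`, with `Re ψ(ζ) ≥ c|Re ζ|^ν − C` on the strip. -/
structure IsAdmissibleCharExponent (lm lp ν : ℝ) (ψ : ℂ → ℂ) : Prop where
  lm_neg : lm < 0
  lp_pos : 0 < lp
  ν_pos : 0 < ν
  ν_le_two : ν ≤ 2
  continuous : ContinuousOn ψ {ζ : ℂ | lm ≤ ζ.im ∧ ζ.im ≤ lp}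
  holomorphic : DifferentiableOn ℂ ψ {ζ : ℂ | lm < ζ.im ∧ ζ.im < lp}
  map_zero : ψ 0 = 0
  growth : ∃ c > 0, ∃ C ≥ 0, ∀ ζ : ℂ, lm ≤ ζ.im → ζ.im ≤ lp →
    c * |ζ.re| ^ ν - C ≤ (ψ ζ).re

/-- A real random variable `Y` on `(Ω, P)` has characteristic exponent `ψ` (of type
`[lm, lp]`) over time `τ`: `E[e^{−vY}] < ∞` for all `v ∈ [lm, lp]` and
`E[e^{iζY}] = e^{−τψ(ζ)}` for all `ζ` with `Im ζ ∈ [lm, lp]`. -/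
structure HasCharExponent {Ω : Type*} [MeasurableSpace Ω] (P : Measure Ω) (Y : Ω → ℝ)
    (lm lp : ℝ) (ψ : ℂ → ℂ) (τ : ℝ) : Prop where
  integrable_exp : ∀ v : ℝ, lm ≤ v → v ≤ lp → Integrable (fun s => Real.exp (-v * Y s)) P
  charFun_eq : ∀ ζ : ℂ, lm ≤ ζ.im → ζ.im ≤ lp →
    ∫ s, Complex.exp (Complex.I * ζ * (Y s : ℂ)) ∂P = Complex.exp (-(τ : ℂ) * ψ ζ)

/-- Iterated integral of `F : ℝ^N → ℂ`, computed coordinate by coordinate,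
innermost integral first (i.e. in the order `dξ₁`, then `dξ₂`, …, then `dξ_N`). -/
noncomputable def iterIntegral : (N : ℕ) → ((Fin N → ℝ) → ℂ) → ℂ
  | 0, F => F (fun i => i.elim0)
  | N + 1, F => iterIntegral N fun v => ∫ u : ℝ, F (Fin.cons u v)

/-- All the successive iterated integrals of `F : ℝ^N → ℂ` (in the order `dξ₁`, …, `dξ_N`)
exist. -/
def IterIntegrable : (N : ℕ) → ((Fin N → ℝ) → ℂ) → Prop
  | 0, _ => True
  | N + 1, F => (∀ v : Fin N → ℝ, Integrable fun u : ℝ => F (Fin.cons u v)) ∧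
      IterIntegrable N fun v => ∫ u : ℝ, F (Fin.cons u v)

/-- The contour integrand of Lemma 3, as a function of the real parts
`u n` of the variables `ξ n = u n − i w n ω n`. -/
noncomputable def integrand6 {N : ℕ} (ψ : ℂ → ℂ) (τ x γ : ℝ) (a K w ω : Fin N → ℝ)
    (u : Fin N → ℝ) : ℂ :=
  Complex.exp (Complex.I * (∑ n, ((u n : ℂ) - (w n * ω n : ℝ) * Complex.I)
        * ((a n * x - K n : ℝ) : ℂ))
      - (τ : ℂ) * ψ ((∑ n, (a n : ℂ) * ((u n : ℂ) - (w n * ω n : ℝ) * Complex.I))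
          - Complex.I * (γ : ℂ)))
    / ∏ n, ((u n : ℂ) - (w n * ω n : ℝ) * Complex.I)

open Filter Topology

theorem measure_singleton_zero_of_tendsto_charFun (μ : Measure ℝ) [IsProbabilityMeasure μ]
    (h : Tendsto (charFun μ) atTop (𝓝 0)) (h' : Tendsto (charFun μ) atBot (𝓝 0)) :
    μ {0} = 0 := by
  have h1 : Tendsto (fun n : ℕ => ∫ t in (-1 : ℝ)..1, charFun μ ((n : ℝ) * t)) atTop
      (𝓝 (∫ t in (-1 : ℝ)..1, (0 : ℂ))) := by
    apply intervalIntegral.tendsto_integral_filter_of_dominated_convergence (fun _ => 1)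
    · refine Eventually.of_forall fun n => ?_
      exact ((measurable_charFun (μ := μ)).comp
        (measurable_const_mul (n : ℝ))).aestronglyMeasurable
    · exact Eventually.of_forall fun n => Eventually.of_forall fun t _ => norm_charFun_le_one _
    · simp
    · have : ∀ᵐ t : ℝ, t ≠ 0 := by simp [ae_iff]
      filter_upwards [this] with t ht _
      rcases lt_or_gt_of_ne ht with ht | ht
      · exact h'.comp (tendsto_natCast_atTop_atTop.atTop_mul_const_of_neg ht)
      · exact h.comp (tendsto_natCast_atTop_atTop.atTop_mul_const ht)
  have h2 : Tendsto (fun n : ℕ => ∫ x, sinc ((n : ℝ) * x) ∂μ) atTop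
      (𝓝 (∫ x, ({0} : Set ℝ).indicator (fun _ => (1 : ℝ)) x ∂μ)) := by
    apply tendsto_integral_of_dominated_convergence (fun _ => 1)
    · intro n
      exact (continuous_sinc.comp (continuous_const_mul _)).aestronglyMeasurable
    · simp
    · intro n
      exact Eventually.of_forall fun x => abs_sinc_le_one _
    · refine Eventually.of_forall fun x => ?_
      by_cases hx : x = 0
      · simp [hx]
      · simp only [Set.mem_singleton_iff, hx, not_false_eq_true, Set.indicator_of_notMem]
        have hlim : Tendsto (fun n : ℕ => |(n : ℝ) * x|⁻¹) atTop (𝓝 0) := by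
          simp only [abs_mul, Nat.abs_cast]
          exact tendsto_inv_atTop_zero.comp
            (tendsto_natCast_atTop_atTop.atTop_mul_const (abs_pos.2 hx))
        refine squeeze_zero_norm' ?_ hlim
        filter_upwards [eventually_gt_atTop 0] with n hn
        have hn' : (n : ℝ) * x ≠ 0 := mul_ne_zero (by positivity) hx
        rw [sinc_of_ne_zero hn', norm_eq_abs, abs_div, div_eq_mul_inv]
        exact mul_le_of_le_one_left (by positivity) (abs_sin_le_one _)
  have h3 : Tendsto (fun n : ℕ => ((∫ x, sinc ((n : ℝ) * x) ∂μ : ℝ) : ℂ)) atTop (𝓝 0) := by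
    have := h1.const_mul (1 / 2 : ℂ)
    simp only [intervalIntegral.integral_zero, mul_zero] at this
    refine this.congr' ?_
    filter_upwards [eventually_gt_atTop 0] with n hn
    have hn' : (0 : ℝ) < n := by positivity
    rw [intervalIntegral.integral_comp_mul_left _ hn'.ne', mul_neg_one, mul_one,
      integral_charFun_Icc hn', Complex.real_smul]
    push_cast
    have : (n : ℂ) ≠ 0 := by exact_mod_cast hn.ne'
    field_simp
  have h4 := tendsto_nhds_unique ((continuous_ofReal.tendsto _).comp h2) h3
  rw [integral_indicator_const _ (measurableSet_singleton 0)] at h4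
  simpa [measureReal_def, ENNReal.toReal_eq_zero_iff] using h4

section

variable {Ω : Type*} [MeasurableSpace Ω] {P : Measure Ω}

/-- The expectation of `H` against the product of the kernels `exp (i ξ n Z n) / ξ n`, as a
function of the real parts `u n` of `ξ n = u n - i w n ω n`. -/
noncomputable def contourIntegrand {N : ℕ} (P : Measure Ω) (H : Ω → ℂ) (Z : Fin N → Ω → ℝ)
    (w ω : Fin N → ℝ) (u : Fin N → ℝ) : ℂ :=
  ∫ s, H s * ∏ n, cexp (I * ((u n : ℂ) - (w n * ω n : ℝ) * I) * Z n s)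
    / ((u n : ℂ) - (w n * ω n : ℝ) * I) ∂P

theorem integrable_prod_indicator_Iic_exp [SFinite P] {H : Ω → ℂ} {Z : Ω → ℝ} {c : ℂ} (hc : 0 < c.re)
    (hH : AEStronglyMeasurable H P) (hZ : AEMeasurable Z P)
    (hint : Integrable (fun s => (Real.exp (c.re * Z s) : ℂ) * H s) P) :
    Integrable (Function.uncurry fun (s : Ω) (y : ℝ) =>
      H s * (Set.Iic (Z s)).indicator (fun y : ℝ => cexp (c * y)) y) (P.prod volume) := by
  have hmeas : AEStronglyMeasurable (Function.uncurry fun (s : Ω) (y : ℝ) =>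
      H s * (Set.Iic (Z s)).indicator (fun y : ℝ => cexp (c * y)) y) (P.prod volume) := by
    have hset : NullMeasurableSet {p : Ω × ℝ | p.2 ≤ Z p.1} (P.prod volume) :=
      nullMeasurableSet_le measurable_snd.aemeasurable hZ.comp_fst
    have h1 : AEStronglyMeasurable
        ({p : Ω × ℝ | p.2 ≤ Z p.1}.indicator fun p => cexp (c * p.2)) (P.prod volume) :=
      AEStronglyMeasurable.indicator₀ (by fun_prop) hset
    exact hH.comp_fst.mul h1
  rw [integrable_prod_iff hmeas]
  constructor
  · refine Eventually.of_forall fun s => Integrable.const_mul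
      (f := (Set.Iic (Z s)).indicator fun y : ℝ => cexp (c * y)) ?_ (H s)
    exact (integrable_indicator_iff measurableSet_Iic).2
      (integrableOn_exp_mul_complex_Iic hc (Z s))
  · refine (hint.norm.div_const c.re).congr (Eventually.of_forall fun s => ?_)
    have : ∀ y : ℝ, ‖H s * (Set.Iic (Z s)).indicator (fun y : ℝ => cexp (c * y)) y‖
        = ‖H s‖ * (Set.Iic (Z s)).indicator (fun y : ℝ => Real.exp (c.re * y)) y := by
      intro y
      rw [norm_mul, Set.indicator_apply, Set.indicator_apply]
      split_ifs <;> simp [Complex.norm_exp]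
    simp only [Function.uncurry_apply_pair, this]
    rw [integral_const_mul, integral_indicator measurableSet_Iic, integral_exp_mul_Iic hc,
      norm_mul, Complex.norm_real, norm_eq_abs, abs_of_pos (Real.exp_pos _)]
    ring

theorem integral_contour_eq_of_pos [SFinite P] {H : Ω → ℂ} {Z : Ω → ℝ} {ω : ℝ} (hω : 0 < ω)
    (hH : AEStronglyMeasurable H P) (hZ : AEMeasurable Z P) (hZ0 : ∀ᵐ s ∂P, Z s ≠ 0)
    (hint : Integrable (fun s => (Real.exp (ω * Z s) : ℂ) * H s) P)
    (hφ : Integrable fun u : ℝ =>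
      (∫ s, H s * cexp (I * ((u : ℂ) - ω * I) * Z s) ∂P) / ((u : ℂ) - ω * I)) :
    ∫ u : ℝ, (∫ s, H s * cexp (I * ((u : ℂ) - ω * I) * Z s) ∂P) / ((u : ℂ) - ω * I)
      = 2 * π * I * ∫ s, H s * (if 0 ≤ Z s then 1 else 0) ∂P := by
  set G : ℝ → ℂ := fun u =>
    (∫ s, H s * cexp (I * ((u : ℂ) - ω * I) * Z s) ∂P) / ((u : ℂ) - ω * I) with hG
  set g : ℝ → ℂ := fun y =>
    ∫ s, H s * (Set.Iic (Z s)).indicator (fun y : ℝ => cexp ((ω : ℂ) * y)) y ∂P with hg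
  have hgint : Integrable g :=
    (integrable_prod_indicator_Iic_exp (c := (ω : ℂ)) (by simpa) hH hZ
      (by simpa using hint)).integral_prod_right
  have hfour : ∀ t : ℝ, FourierTransform.fourier g t = G (-(2 * π) * t) / I := by
    intro t
    set c : ℂ := ω - 2 * π * t * I with hc
    have hcre : c.re = ω := by simp [hc]
    have hcne : c ≠ 0 := by
      intro h; rw [h] at hcre; simp at hcre; exact hω.ne hcre
    have hi := integrable_prod_indicator_Iic_exp (c := c) (by rwa [hcre]) hH hZ
      (by simpa [hcre] using hint)
    rw [Real.fourier_real_eq_integral_exp_smul]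
    have h1 : ∀ y : ℝ, cexp (↑(-2 * π * y * t) * I) • g y =
        ∫ s, H s * (Set.Iic (Z s)).indicator (fun y : ℝ => cexp (c * y)) y ∂P := by
      intro y
      rw [hg, smul_eq_mul, ← integral_const_mul]
      congr 1 with s
      rw [Set.indicator_apply, Set.indicator_apply]
      split_ifs
      · rw [mul_left_comm, ← Complex.exp_add, hc]
        push_cast
        ring_nf
      · simp
    simp_rw [h1]
    rw [← integral_integral_swap hi]
    have h2 : ∀ s, ∫ y : ℝ, H s * (Set.Iic (Z s)).indicator (fun y : ℝ => cexp (c * y)) y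
        = H s * cexp (c * Z s) * c⁻¹ := by
      intro s
      rw [integral_const_mul, integral_indicator measurableSet_Iic,
        integral_exp_mul_complex_Iic (by rwa [hcre])]
      ring
    simp_rw [h2]
    rw [integral_mul_const, hG]
    have h3 : I * (((-(2 * π) * t : ℝ) : ℂ) - ω * I) = c := by
      rw [hc]; push_cast; ring_nf; simp
    simp only [h3]
    rw [div_div, mul_comm _ I, h3, div_eq_mul_inv]
  have h2pi : (-(2 * π)) ≠ 0 := by simp [Real.pi_ne_zero]
  have hfint : Integrable (FourierTransform.fourier g) := by
    rw [show FourierTransform.fourier g = fun t => G (-(2 * π) * t) / I from funext hfour]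
    exact (hφ.comp_mul_left' h2pi).div_const I
  have hcont : ContinuousAt g 0 := by
    apply continuousAt_of_dominated (bound := fun s => ‖(Real.exp (ω * Z s) : ℂ) * H s‖)
    · refine Eventually.of_forall fun y => hH.mul ?_
      have : (fun s => (Set.Iic (Z s)).indicator (fun y : ℝ => cexp ((ω : ℂ) * y)) y)
          = {s | y ≤ Z s}.indicator fun _ => cexp ((ω : ℂ) * y) := by
        ext s; simp [Set.indicator_apply]
      rw [this]
      exact aestronglyMeasurable_const.indicator₀ (nullMeasurableSet_le aemeasurable_const hZ)
    · refine Eventually.of_forall fun y => Eventually.of_forall fun s => ?_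
      rw [norm_mul, norm_mul, mul_comm]
      refine mul_le_mul_of_nonneg_right ?_ (norm_nonneg _)
      rw [Set.indicator_apply, Complex.norm_real, norm_eq_abs, abs_of_pos (Real.exp_pos _)]
      split_ifs with h
      · rw [Complex.norm_exp]
        simpa using! mul_le_mul_of_nonneg_left h hω.le
      · simpa using (Real.exp_pos _).le
    · exact hint.norm
    · filter_upwards [hZ0] with s hs
      refine continuousAt_const.mul ?_
      rcases lt_or_gt_of_ne hs with h | h
      · refine (continuousAt_const (y := (0 : ℂ))).congr ?_
        filter_upwards [lt_mem_nhds h] with y hy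
        simp [hy]
      · have : ContinuousAt (fun y : ℝ => cexp ((ω : ℂ) * y)) 0 := by fun_prop
        refine this.congr ?_
        filter_upwards [gt_mem_nhds h] with y hy
        simp [hy.le]
  have hinv := hgint.fourierInv_fourier_eq hfint hcont
  rw [Real.fourierInv_eq'] at hinv
  simp only [hfour, inner_zero_right, mul_zero, ofReal_zero, zero_mul, Complex.exp_zero,
    one_smul] at hinv
  rw [integral_div, Measure.integral_comp_mul_left] at hinv
  have hg0 : g 0 = ∫ s, H s * (if 0 ≤ Z s then 1 else 0) ∂P := by
    simp [hg, Set.indicator_apply]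
  rw [← hg0, ← hinv, abs_inv, abs_neg, abs_of_pos (by positivity), Complex.real_smul]
  have : (π : ℂ) ≠ 0 := by exact_mod_cast Real.pi_ne_zero
  push_cast
  field_simp

theorem integral_contour_eq [SFinite P] {H : Ω → ℂ} {Z : Ω → ℝ} {w ω : ℝ}
    (hw : w = 1 ∨ w = -1) (hω : 0 < ω)
    (hH : AEStronglyMeasurable H P) (hZ : AEMeasurable Z P) (hZ0 : ∀ᵐ s ∂P, Z s ≠ 0)
    (hint : Integrable (fun s => (Real.exp (w * ω * Z s) : ℂ) * H s) P)
    (hφ : Integrable fun u : ℝ =>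
      (∫ s, H s * cexp (I * ((u : ℂ) - (w * ω : ℝ) * I) * Z s) ∂P)
        / ((u : ℂ) - (w * ω : ℝ) * I)) :
    ∫ u : ℝ, (∫ s, H s * cexp (I * ((u : ℂ) - (w * ω : ℝ) * I) * Z s) ∂P)
        / ((u : ℂ) - (w * ω : ℝ) * I)
      = 2 * π * I * w * ∫ s, H s * (if 0 ≤ w * Z s then 1 else 0) ∂P := by
  rcases hw with rfl | rfl
  · simp only [one_mul, ofReal_one, mul_one] at *
    exact integral_contour_eq_of_pos hω hH hZ hZ0 hint hφ
  · have key : ∀ u : ℝ, (∫ s, H s * cexp (I * ((-u : ℝ) - (-1 * ω : ℝ) * I) * Z s) ∂P)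
        / (((-u : ℝ) : ℂ) - (-1 * ω : ℝ) * I)
        = -((∫ s, H s * cexp (I * ((u : ℂ) - ω * I) * (-Z s : ℝ)) ∂P) / ((u : ℂ) - ω * I)) := by
      intro u
      rw [← div_neg]
      congr 1
      · congr 1 with s
        push_cast
        ring_nf
      · push_cast
        ring
    have h := integral_contour_eq_of_pos (P := P) (H := H) (Z := fun s => -Z s) hω hH hZ.neg
      (by simpa using hZ0) (by simpa using hint) (by
        have := hφ.comp_neg
        simp only [key] at this
        simpa using this.neg)
    rw [← integral_neg_eq_self]
    simp only [key]
    rw [integral_neg, h]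
    simp


theorem iterIntegral_contour_eq [SFinite P] : ∀ {N : ℕ} {H : Ω → ℂ} {Z : Fin N → Ω → ℝ}
    {w ω : Fin N → ℝ}, (∀ n, w n = 1 ∨ w n = -1) → (∀ n, 0 < ω n) →
    AEStronglyMeasurable H P → (∀ n, AEMeasurable (Z n) P) → (∀ n, ∀ᵐ s ∂P, Z n s ≠ 0) →
    Integrable (fun s => (Real.exp (∑ n, w n * ω n * Z n s) : ℂ) * H s) P →
    IterIntegrable N (contourIntegrand P H Z w ω) →
    iterIntegral N (contourIntegrand P H Z w ω)
      = (2 * π * I) ^ N * (∏ n, (w n : ℂ)) *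
        ∫ s, H s * ∏ n, (if 0 ≤ w n * Z n s then (1 : ℂ) else 0) ∂P
  | 0, H, Z, w, ω, _, _, _, _, _, _, _ => by simp [iterIntegral, contourIntegrand]
  | N + 1, H, Z, w, ω, hw, hω, hH, hZ, hZ0, hint, hiter => by
    have hcons : ∀ (v : Fin N → ℝ) (u : ℝ), contourIntegrand P H Z w ω (Fin.cons u v)
        = (∫ s, (H s * ∏ n : Fin N, cexp (I * ((v n : ℂ) - (w n.succ * ω n.succ : ℝ) * I)
              * Z n.succ s) / ((v n : ℂ) - (w n.succ * ω n.succ : ℝ) * I))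
            * cexp (I * ((u : ℂ) - (w 0 * ω 0 : ℝ) * I) * Z 0 s) ∂P)
          / ((u : ℂ) - (w 0 * ω 0 : ℝ) * I) := by
      intro v u
      rw [contourIntegrand, ← integral_div]
      congr 1 with s
      rw [Fin.prod_univ_succ]
      simp only [Fin.cons_zero, Fin.cons_succ]
      ring
    have hind : AEStronglyMeasurable (fun s => if 0 ≤ w 0 * Z 0 s then (1 : ℂ) else 0) P := by
      refine (Measurable.comp_aemeasurable (g := fun z : ℝ => if 0 ≤ w 0 * z then (1 : ℂ) else 0)
        ?_ (hZ 0)).aestronglyMeasurable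
      exact Measurable.ite (measurableSet_le measurable_const (by fun_prop))
        measurable_const measurable_const
    have hinner : ∀ v : Fin N → ℝ, ∫ u : ℝ, contourIntegrand P H Z w ω (Fin.cons u v)
        = contourIntegrand P
            (fun s => 2 * π * I * w 0 * (H s * if 0 ≤ w 0 * Z 0 s then 1 else 0))
            (fun n => Z n.succ) (fun n => w n.succ) (fun n => ω n.succ) v := by
      intro v
      have hfac : AEStronglyMeasurable (fun s => ∏ n : Fin N,
          cexp (I * ((v n : ℂ) - (w n.succ * ω n.succ : ℝ) * I) * Z n.succ s)
            / ((v n : ℂ) - (w n.succ * ω n.succ : ℝ) * I)) P := by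
        refine AEMeasurable.aestronglyMeasurable ?_
        refine Finset.aemeasurable_fun_prod _ fun n _ => ?_
        have := hZ n.succ
        fun_prop
      have hint' : Integrable (fun s => (Real.exp (w 0 * ω 0 * Z 0 s) : ℂ) *
          (H s * ∏ n : Fin N, cexp (I * ((v n : ℂ) - (w n.succ * ω n.succ : ℝ) * I)
              * Z n.succ s) / ((v n : ℂ) - (w n.succ * ω n.succ : ℝ) * I))) P := by
        refine (hint.norm.mul_const
          (∏ n : Fin N, ‖(v n : ℂ) - (w n.succ * ω n.succ : ℝ) * I‖⁻¹)).mono' ?_ ?_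
        · have := hZ 0
          refine AEStronglyMeasurable.mul ?_ (hH.mul hfac)
          exact AEMeasurable.aestronglyMeasurable (by fun_prop)
        · refine Eventually.of_forall fun s => le_of_eq ?_
          simp only [norm_mul, norm_prod, norm_inv, Complex.norm_exp, div_eq_mul_inv,
            Finset.prod_mul_distrib, Complex.norm_real, norm_eq_abs, abs_of_pos (Real.exp_pos _)]
          have h1 : ∀ n : Fin N, (I * ((v n : ℂ) - (w n.succ * ω n.succ : ℝ) * I)
              * Z n.succ s).re = w n.succ * ω n.succ * Z n.succ s := by
            intro n
            simp
          simp only [h1]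
          rw [← Real.exp_sum, Fin.sum_univ_succ, Real.exp_add]
          ring
      have hφ := hiter.1 v
      simp only [hcons] at hφ ⊢
      refine (integral_contour_eq (hw 0) (hω 0) (hH.mul hfac) (hZ 0) (hZ0 0) hint' hφ).trans ?_
      rw [contourIntegrand, ← integral_const_mul]
      congr 1 with s
      simp only [Pi.mul_apply]
      ring
    have hiter' := hiter.2
    rw [iterIntegral]
    rw [funext hinner] at hiter' ⊢
    rw [iterIntegral_contour_eq (H := fun s =>
        2 * π * I * w 0 * (H s * if 0 ≤ w 0 * Z 0 s then 1 else 0)) (fun n => hw n.succ) (fun n => hω n.succ)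
      ((hH.mul hind).const_mul _) (fun n => hZ n.succ) (fun n => hZ0 n.succ) ?_ hiter']
    · simp only [Fin.prod_univ_succ, mul_assoc (2 * (π : ℂ) * I * w 0), integral_const_mul]
      simp only [← mul_assoc]
      ring
    · refine (hint.norm.const_mul ‖2 * (π : ℂ) * I * w 0‖).mono' ?_ ?_
      · refine AEStronglyMeasurable.mul ?_ ((hH.mul hind).const_mul _)
        have : ∀ n : Fin N, AEMeasurable (Z n.succ) P := fun n => hZ n.succ
        have hsum : AEMeasurable (fun s => ∑ n : Fin N, w n.succ * ω n.succ * Z n.succ s) P :=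
          Finset.aemeasurable_fun_sum _ fun n _ => (this n).const_mul _
        exact AEMeasurable.aestronglyMeasurable (by fun_prop)
      · refine Eventually.of_forall fun s => ?_
        simp only [norm_mul, Complex.norm_real, norm_eq_abs, abs_of_pos (Real.exp_pos _),
          Fin.sum_univ_succ, Real.exp_add]
        have h1 : ‖(if 0 ≤ w 0 * Z 0 s then (1 : ℂ) else 0)‖
            ≤ Real.exp (w 0 * ω 0 * Z 0 s) := by
          split_ifs with h
          · rw [norm_one]
            refine Real.one_le_exp ?_
            rw [mul_right_comm]
            exact mul_nonneg h (hω 0).le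
          · simpa using (Real.exp_pos _).le
        have h2 := mul_le_mul_of_nonneg_left h1
          (by positivity : 0 ≤ ‖(2 : ℂ)‖ * |π| * ‖I‖ * |w 0| * ‖H s‖
            * Real.exp (∑ n : Fin N, w n.succ * ω n.succ * Z n.succ s))
        linarith

end

theorem IsAdmissibleCharExponent.tendsto_exp_cocompact {lm lp ν : ℝ} {ψ : ℂ → ℂ}
    (hψ : IsAdmissibleCharExponent lm lp ν ψ) {τ : ℝ} (hτ : 0 < τ) :
    Tendsto (fun u : ℝ => cexp (-(τ : ℂ) * ψ u)) (cocompact ℝ) (𝓝 0) := by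
  obtain ⟨c, hc, C, -, hgrow⟩ := hψ.growth
  rw [Complex.tendsto_exp_nhds_zero_iff]
  have habs : Tendsto (fun u : ℝ => |u|) (cocompact ℝ) atTop := tendsto_norm_cocompact_atTop
  have h1 : Tendsto (fun u : ℝ => -(τ * (c * |u| ^ ν - C))) (cocompact ℝ) atBot :=
    tendsto_neg_atTop_atBot.comp ((tendsto_atTop_add_const_right _ (-C)
      (((tendsto_rpow_atTop hψ.ν_pos).comp habs).const_mul_atTop hc)).const_mul_atTop hτ)
  refine tendsto_atBot_mono (fun u => ?_) h1
  have := mul_le_mul_of_nonneg_left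
    (hgrow u (by simpa using hψ.lm_neg.le) (by simpa using hψ.lp_pos.le)) hτ.le
  simpa using this

namespace HasCharExponent

variable {Ω : Type*} [MeasurableSpace Ω] {P : Measure Ω} {Y : Ω → ℝ} {lm lp ν τ : ℝ} {ψ : ℂ → ℂ}

theorem aemeasurable (hY : HasCharExponent P Y lm lp ψ τ) (hlm : lm < 0) (hlp : 0 < lp) :
    AEMeasurable Y P := by
  have h := (hY.integrable_exp lm le_rfl (hlm.trans hlp).le).aestronglyMeasurable.aemeasurable
  refine ((Real.measurable_log.comp_aemeasurable h).const_mul (-lm)⁻¹).congr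
    (Eventually.of_forall fun s => ?_)
  have : lm ≠ 0 := hlm.ne
  simp only [Function.comp_apply, Real.log_exp]
  field_simp

theorem ae_ne [IsProbabilityMeasure P] (hψ : IsAdmissibleCharExponent lm lp ν ψ) (hτ : 0 < τ)
    (hY : HasCharExponent P Y lm lp ψ τ) (y : ℝ) : ∀ᵐ s ∂P, Y s ≠ y := by
  have hm := hY.aemeasurable hψ.lm_neg hψ.lp_pos
  have hm' : AEMeasurable (fun s => Y s - y) P := hm.sub_const y
  have : IsProbabilityMeasure (P.map fun s => Y s - y) := Measure.isProbabilityMeasure_map hm'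
  have hchar : ∀ u : ℝ, charFun (P.map fun s => Y s - y) u
      = cexp (-(τ : ℂ) * ψ u) * cexp (-(u * y : ℝ) * I) := by
    intro u
    rw [← hY.charFun_eq u (by simpa using hψ.lm_neg.le) (by simpa using hψ.lp_pos.le),
      charFun_apply_real, integral_map hm' (by fun_prop), ← integral_mul_const]
    congr 1 with s
    rw [← Complex.exp_add]
    push_cast
    ring_nf
  have hlim : Tendsto (charFun (P.map fun s => Y s - y)) (cocompact ℝ) (𝓝 0) := by
    rw [tendsto_zero_iff_norm_tendsto_zero]
    refine (hψ.tendsto_exp_cocompact hτ).norm.congr' ?_ |>.trans (by simp)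
    refine Eventually.of_forall fun u => ?_
    change ‖_‖ = ‖_‖
    rw [hchar, norm_mul, ← ofReal_neg (u * y), norm_exp_ofReal_mul_I, mul_one]
  rw [cocompact_eq_atBot_atTop, tendsto_sup] at hlim
  have h0 := measure_singleton_zero_of_tendsto_charFun _ hlim.2 hlim.1
  rw [Measure.map_apply_of_aemeasurable hm' (measurableSet_singleton 0)] at h0
  rw [ae_iff]
  convert h0 using 2
  ext s
  simp [sub_eq_zero]

end HasCharExponent

/-- Multi-constraint power digital option pricing (Lemma 3). -/
theorem stmt6 {Ω : Type*} [MeasurableSpace Ω] (P : Measure Ω) [IsProbabilityMeasure P]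
    (lm lp ν : ℝ) (ψ : ℂ → ℂ) (hψ : IsAdmissibleCharExponent lm lp ν ψ)
    (τ : ℝ) (hτ : 0 < τ) (x r : ℝ) (Y : Ω → ℝ) (hY : HasCharExponent P Y lm lp ψ τ)
    {N : ℕ} (γ : ℝ) (a K w ω : Fin N → ℝ)
    (ha : ∀ n, a n ≠ 0) (hw : ∀ n, w n = 1 ∨ w n = -1) (hω : ∀ n, 0 < ω n)
    (hstrip₁ : -lp < (∑ n, w n * ω n * a n) + γ)
    (hstrip₂ : (∑ n, w n * ω n * a n) + γ < -lm)
    (hiter : IterIntegrable N (integrand6 ψ τ x γ a K w ω)) :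
    ((Real.exp (-r * τ) * ∫ s, Real.exp (γ * (x + Y s)) *
        ∏ n, (if w n * (a n * (x + Y s)) ≥ w n * K n then (1 : ℝ) else 0) ∂P : ℝ) : ℂ)
      = ((Real.exp (-r * τ) * Real.exp (γ * x) : ℝ) : ℂ) * (∏ n, (w n : ℂ))
          / (2 * Real.pi * Complex.I) ^ N
          * iterIntegral N (integrand6 ψ τ x γ a K w ω) := by
  have hYm := hY.aemeasurable hψ.lm_neg hψ.lp_pos
  have hrewrite : integrand6 ψ τ x γ a K w ω = contourIntegrand P (fun s => (Real.exp (γ * Y s) : ℂ))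
      (fun n s => a n * (x + Y s) - K n) w ω := by
    ext u
    set ζ : ℂ := (∑ n, (a n : ℂ) * ((u n : ℂ) - (w n * ω n : ℝ) * I)) - I * (γ : ℂ) with hζ
    have hζim : ζ.im = -((∑ n, w n * ω n * a n) + γ) := by
      have : ∀ n, a n * (w n * ω n) = w n * ω n * a n := fun n => by ring
      simp [hζ, this]
      ring
    have hchar := hY.charFun_eq ζ (by rw [hζim]; linarith) (by rw [hζim]; linarith)
    rw [integrand6, ← hζ, sub_eq_add_neg, ← neg_mul, Complex.exp_add, ← hchar, contourIntegrand,
      ← integral_const_mul, ← integral_div]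
    congr 1 with s
    rw [Finset.prod_div_distrib, ← Complex.exp_sum, ← mul_div_assoc, ← Complex.exp_add,
      ofReal_exp, ← Complex.exp_add]
    congr 2
    have h1 : ∀ n, I * ((u n : ℂ) - (w n * ω n : ℝ) * I) * ((a n * (x + Y s) - K n : ℝ) : ℂ)
        = I * (((u n : ℂ) - (w n * ω n : ℝ) * I) * ((a n * x - K n : ℝ) : ℂ))
          + I * Y s * (a n * ((u n : ℂ) - (w n * ω n : ℝ) * I)) := by
      intro n
      push_cast
      ring
    simp only [h1]
    rw [Finset.sum_add_distrib, ← Finset.mul_sum, ← Finset.mul_sum, hζ]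
    push_cast
    linear_combination (-(γ : ℂ) * Y s) * I_sq
  have hZ0 : ∀ n, ∀ᵐ s ∂P, a n * (x + Y s) - K n ≠ 0 := by
    intro n
    filter_upwards [hY.ae_ne hψ hτ (K n / a n - x)] with s hs h
    refine hs ?_
    have := ha n
    field_simp
    linarith
  have hint : Integrable (fun s => (Real.exp (∑ n, w n * ω n * (a n * (x + Y s) - K n)) : ℂ)
      * (Real.exp (γ * Y s) : ℂ)) P := by
    have h := (hY.integrable_exp (-((∑ n, w n * ω n * a n) + γ)) (by linarith)
      (by linarith)).const_mul (Real.exp (∑ n, w n * ω n * (a n * x - K n)))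
    refine h.ofReal.congr (Eventually.of_forall fun s => ?_)
    simp only [← ofReal_mul, ← Real.exp_add]
    congr 2
    have h1 : ∀ n, w n * ω n * (a n * (x + Y s) - K n)
        = w n * ω n * (a n * x - K n) + w n * ω n * a n * Y s := fun n => by ring
    simp only [h1, Finset.sum_add_distrib, ← Finset.sum_mul]
    ring
  rw [hrewrite] at hiter ⊢
  rw [iterIntegral_contour_eq hw hω
    (AEMeasurable.aestronglyMeasurable (by fun_prop)) (fun n => by fun_prop) hZ0 hint hiter]
  have hw2 : (∏ n, (w n : ℂ)) * ∏ n, (w n : ℂ) = 1 := by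
    rw [← Finset.prod_mul_distrib]
    refine Finset.prod_eq_one fun n _ => ?_
    rcases hw n with h | h <;> simp [h]
  have hpayoff : ((∫ s, Real.exp (γ * (x + Y s)) *
        ∏ n, (if w n * (a n * (x + Y s)) ≥ w n * K n then (1 : ℝ) else 0) ∂P : ℝ) : ℂ)
      = (Real.exp (γ * x) : ℂ) * ∫ s, (Real.exp (γ * Y s) : ℂ) *
        ∏ n, (if 0 ≤ w n * (a n * (x + Y s) - K n) then (1 : ℂ) else 0) ∂P := by
    rw [← integral_complex_ofReal, ← integral_const_mul]
    congr 1 with s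
    rw [mul_add, Real.exp_add, ← mul_assoc]
    push_cast
    congr 2 with n
    simp only [mul_sub, sub_nonneg, ge_iff_le]
    split_ifs <;> simp
  have hpi : (2 * (π : ℂ) * I) ^ N ≠ 0 := pow_ne_zero _ two_pi_I_ne_zero
  rw [ofReal_mul, hpayoff, ofReal_mul]
  rw [div_mul_eq_mul_div, eq_div_iff hpi]
  linear_combination (-(Real.exp (-r * τ) : ℂ) * Real.exp (γ * x) * (2 * π * I) ^ N *
    ∫ s, (Real.exp (γ * Y s) : ℂ) *
        ∏ n, (if 0 ≤ w n * (a n * (x + Y s) - K n) then (1 : ℂ) else 0) ∂P) * hw2
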